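/- Let F act on a tree T with orientation o and base vertex v₀, and let δ : V → V be the Dehn twist map based at v₀ (a bijection of V). Then for every w ∈ F, the conjugate δ ∘ (w • ·) ∘ δ⁻¹ of the action of w by δ is again given by the action of an element of F; explicitly, if e₁,…,e_k are the oriented edges of the unique path from v₀ to w • v₀, then for every vertex v ∈ V, δ(w • δ⁻¹(v)) = (o(e₁)⋯o(e_k) · w) • v. -/

import Mathlib

/-- The product `o(e₁)⋯o(e_k)` of the orientation values over the consecutive
oriented edges (darts) of a walk `p`. -/
def walkProd {V F : Type*} [Group F] {G : SimpleGraph V} {u v : V}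
    (o : V → V → F) (p : G.Walk u v) : F :=
  (p.darts.map fun d => o d.toProd.1 d.toProd.2).prod

theorem walkProd_nil {V F : Type*} [Group F] {G : SimpleGraph V} (o : V → V → F) (u : V) :
    walkProd o (SimpleGraph.Walk.nil : G.Walk u u) = 1 := by
  simp [walkProd]

theorem walkProd_cons {V F : Type*} [Group F] {G : SimpleGraph V} (o : V → V → F) {u v w : V}
    (h : G.Adj u v) (p : G.Walk v w) :
    walkProd o (SimpleGraph.Walk.cons h p) = o u v * walkProd o p := by
  simp [walkProd]

theorem walkProd_append {V F : Type*} [Group F] {G : SimpleGraph V} (o : V → V → F) {u v w : V}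
    (p : G.Walk u v) (q : G.Walk v w) :
    walkProd o (p.append q) = walkProd o p * walkProd o q := by
  simp [walkProd]

/-- Translating a walk by `w` conjugates its product by `w`, for an equivariant `o`. -/
theorem walkProd_map_smul {V F : Type*} [Group F] [MulAction F V] {G : SimpleGraph V}
    {o : V → V → F} {w : F}
    (ho : ∀ u v, G.Adj u v → o (w • u) (w • v) = w * o u v * w⁻¹)
    (φ : G →g G) (hφ : ∀ v, φ v = w • v) {u v : V} (p : G.Walk u v) :
    walkProd o (p.map φ) = w * walkProd o p * w⁻¹ := by
  induction p with
  | nil => simp [walkProd_nil]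
  | cons h p ih =>
    rw [SimpleGraph.Walk.map_cons, walkProd_cons, walkProd_cons, ih, hφ, hφ, ho _ _ h]
    group

/-- In an acyclic graph, deleting the backtracking of a walk does not change its product. -/
theorem walkProd_bypass {V F : Type*} [Group F] [DecidableEq V] {G : SimpleGraph V}
    (hG : G.IsAcyclic) {o : V → V → F} (ho : ∀ u v, G.Adj u v → o v u = (o u v)⁻¹)
    {u v : V} (p : G.Walk u v) : walkProd o p.bypass = walkProd o p := by
  induction p with
  | nil => rfl
  | @cons u v w h p ih =>
    rw [walkProd_cons, ← ih, SimpleGraph.Walk.bypass]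
    split_ifs with hu
    · have htake : p.bypass.takeUntil u hu = h.symm.toWalk :=
        congrArg Subtype.val ((hG.subsingleton_path v u).elim
          ⟨_, p.bypass_isPath.takeUntil hu⟩ (SimpleGraph.Path.singleton h.symm))
      have hprod := congrArg (walkProd o) (p.bypass.take_spec hu)
      rw [walkProd_append, htake, walkProd_cons, walkProd_nil, ho u v h] at hprod
      simp [← hprod]
    · exact walkProd_cons o h p.bypass

/-- Let `F` act on a tree `G` by graph automorphisms, with orientation `o` and
base vertex `v₀`, and let `δ` (a bijection of `V`) be the Dehn twist map based at
`v₀`.  Then for every `w ∈ F`, the conjugate `δ ∘ (w • ·) ∘ δ⁻¹` of the action of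
`w` by `δ` is again given by the action of an element of `F`: if `e₁,…,e_k` are
the oriented edges of the unique path from `v₀` to `w • v₀`, then
`δ (w • δ⁻¹ v) = (o(e₁)⋯o(e_k) * w) • v` for every vertex `v`. -/
theorem dehnTwist_conj_action
    {V F : Type*} [Group F] [MulAction F V]
    (G : SimpleGraph V) (hT : G.IsTree)
    (hact : ∀ (g : F) (u v : V), G.Adj u v ↔ G.Adj (g • u) (g • v))
    (o : V → V → F)
    (ho1 : ∀ u v, G.Adj u v → o v u = (o u v)⁻¹)
    (ho2 : ∀ (g : F) (u v : V), G.Adj u v → o (g • u) (g • v) = g * o u v * g⁻¹)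
    (ho3 : ∀ u v, G.Adj u v →
      (Subgroup.zpowers (o u v) : Set F) = {g : F | g • u = u ∧ g • v = v})
    (v₀ : V) (δ : V ≃ V)
    (hδ : ∀ (v : V) (p : G.Walk v₀ v), p.IsPath → δ v = walkProd o p • v) :
    ∀ (w : F) (p : G.Walk v₀ (w • v₀)), p.IsPath →
      ∀ v : V, δ (w • δ.symm v) = (walkProd o p * w) • v := by
  classical
  intro w p _ v
  obtain ⟨x, rfl⟩ := δ.surjective v
  obtain ⟨q, hq, -⟩ := hT.existsUnique_path v₀ x
  let φ : G →g G := ⟨(w • ·), fun {a b} h => (hact w a b).1 h⟩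
  let r : G.Walk v₀ (w • x) := p.append (q.map φ)
  rw [δ.symm_apply_apply, hδ x q hq, hδ (w • x) r.bypass r.bypass_isPath,
    walkProd_bypass hT.isAcyclic ho1, walkProd_append,
    walkProd_map_smul (ho2 w) φ fun _ => rfl, smul_smul, smul_smul]
  congr 1
  group
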